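/- arXiv:2302.04353 — 2 statements merged into one kernel-verified Lean document; each statement's English description precedes it below -/
import Mathlib

section
/- Let 0 < α < 1/2, d > 0 and m ≥ 0. There is a constant M (depending only on α and d) with the following property: if k : ℝ × ℝ → ℂ is measurable and satisfies |k(x,y)| ≤ m·(1 + |x| + |y|)^{-3/2} whenever max(|x|,|y|) > d, and |k(x,y)| ≤ m·(1 + |log|x−y||) whenever |x| ≤ d, |y| ≤ d and x ≠ y, then for every continuous function σ : ℝ → ℂ with |σ|_α < ∞ and every x ∈ ℝ, the function y ↦ k(x,y)σ(y) is integrable and |∫_{-∞}^{∞} k(x,y) σ(y) dy| ≤ M · m · |σ|_α · (1 + |x|)^{-(α+1/2)}. -/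
open MeasureTheory

/-- The logarithmic kernel `1 + |log u|`, cut off at distance `r`, is integrable. -/
lemma integrable_indicator_one_add_abs_log (r : ℝ) :
    Integrable ((Set.Icc (-r) r).indicator fun u : ℝ => 1 + |Real.log u|) := by
  rw [integrable_indicator_iff measurableSet_Icc]
  rcases le_or_gt (-r) r with hr | hr
  · rw [← intervalIntegrable_iff_integrableOn_Icc_of_le hr]
    exact intervalIntegrable_const.add intervalIntegral.intervalIntegrable_log'.abs
  · simp [Set.Icc_eq_empty_of_lt hr]

lemma integrableOn_abs_rpow {s : ℝ} (hs : -1 < s) :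
    IntegrableOn (fun t : ℝ => |t| ^ s) (Set.Icc (-1) 1) := by
  have h : IntervalIntegrable (fun t : ℝ => |t| ^ s) volume 0 1 := by
    refine (intervalIntegral.intervalIntegrable_rpow' hs).congr fun t ht => ?_
    rw [Set.uIoc_of_le zero_le_one] at ht
    simp [abs_of_pos ht.1]
  have h' : IntervalIntegrable (fun t : ℝ => |t| ^ s) volume (-1) 0 := by
    simpa using ((IntervalIntegrable.iff_comp_neg).mp h).symm
  rw [← intervalIntegrable_iff_integrableOn_Icc_of_le (by norm_num)]
  exact h'.trans h

/-- The profile of the decaying part of the dominating function is integrable. -/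
lemma integrable_one_add_abs_rpow_mul_abs_rpow {α : ℝ} (hα0 : 0 ≤ α) (hα1 : α < 1) :
    Integrable fun t : ℝ => (1 + |t|) ^ (-(3 / 2) : ℝ) * |t| ^ (-α) := by
  have h₁ : Integrable fun t : ℝ => (1 + |t|) ^ (-(3 / 2) : ℝ) := by
    simpa using integrable_one_add_norm (E := ℝ) (μ := volume) (r := 3 / 2) (by norm_num)
  have h₂ := (integrable_indicator_iff (measurableSet_Icc (a := (-1 : ℝ)) (b := 1))).mpr
    (integrableOn_abs_rpow (s := -α) (by linarith))
  refine (h₁.add h₂).mono' (Measurable.aestronglyMeasurable (by fun_prop)) (.of_forall fun t => ?_)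
  have h3 : 0 ≤ (1 + |t|) ^ (-(3 / 2) : ℝ) := by positivity
  have h4 : 0 ≤ |t| ^ (-α) := by positivity
  rw [Real.norm_of_nonneg (mul_nonneg h3 h4), Pi.add_apply]
  by_cases ht : t ∈ Set.Icc (-1 : ℝ) 1
  · rw [Set.indicator_of_mem ht]
    have : (1 + |t|) ^ (-(3 / 2) : ℝ) ≤ 1 :=
      Real.rpow_le_one_of_one_le_of_nonpos (by linarith [abs_nonneg t]) (by norm_num)
    nlinarith
  · rw [Set.indicator_of_notMem ht, add_zero]
    have h1 : 1 ≤ |t| := by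
      by_contra! h
      exact ht ⟨(abs_lt.mp h).1.le, (abs_lt.mp h).2.le⟩
    exact mul_le_of_le_one_right h3 (Real.rpow_le_one_of_one_le_of_nonpos h1 (by linarith))

/-- The decaying part of the kernel is bounded by a rescaling of its profile. -/
lemma rpow_mul_rpow_le_rescaled {α a t : ℝ} (hα : 0 ≤ α) (ha : 0 < a) (ht : 0 < t) :
    (a + t) ^ (-(3 / 2) : ℝ) * (1 + t) ^ (-α) ≤
      a ^ (-(3 / 2) - α) * ((1 + t / a) ^ (-(3 / 2) : ℝ) * (t / a) ^ (-α)) := by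
  have e1 : a + t = a * (1 + t / a) := by field_simp
  have e2 : t ^ (-α) = a ^ (-α) * (t / a) ^ (-α) := by
    rw [← Real.mul_rpow ha.le (by positivity), mul_div_cancel₀ t ha.ne']
  have h : (1 + t) ^ (-α) ≤ t ^ (-α) :=
    Real.rpow_le_rpow_of_nonpos ht (by linarith) (by linarith)
  calc _ ≤ (a + t) ^ (-(3 / 2) : ℝ) * t ^ (-α) := by gcongr
    _ = _ := by
      rw [e1, e2, Real.mul_rpow ha.le (by positivity), sub_eq_add_neg, Real.rpow_add ha]
      ring

/-- Let `0 < α < 1/2`, `d > 0`, `m ≥ 0`.  There is a constant `M`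
(depending only on `α` and `d`) such that for any measurable kernel `k` with
`|k(x,y)| ≤ m (1+|x|+|y|)^{-3/2}` when `max(|x|,|y|) > d` and a logarithmic bound
`|k(x,y)| ≤ m (1+|log|x-y||)` on the square `|x|,|y| ≤ d` (off the diagonal), and for any
continuous `σ` with `|σ|_α` finite (bounded by `S`), the function `y ↦ k(x,y)σ(y)` is
integrable for every `x` and `|∫ k(x,y)σ(y)dy| ≤ M m S (1+|x|)^{-(α+1/2)}`. -/
theorem kernel_C_mapping_estimate (α d : ℝ) (hα0 : 0 < α) (hα : α < 1 / 2) (hd : 0 < d) :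
    ∃ M : ℝ, 0 < M ∧ ∀ m : ℝ, 0 ≤ m → ∀ k : ℝ → ℝ → ℂ,
      Measurable (Function.uncurry k) →
      (∀ x y : ℝ, d < max (|x|) (|y|) → ‖k x y‖ ≤ m * (1 + |x| + |y|) ^ (-(3 / 2) : ℝ)) →
      (∀ x y : ℝ, |x| ≤ d → |y| ≤ d → x ≠ y →
        ‖k x y‖ ≤ m * (1 + |Real.log (|x - y|)|)) →
      ∀ σ : ℝ → ℂ, Continuous σ → ∀ S : ℝ,
        (∀ y : ℝ, (1 + |y|) ^ α * ‖σ y‖ ≤ S) →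
        ∀ x : ℝ, Integrable (fun y => k x y * σ y) ∧
          ‖∫ y : ℝ, k x y * σ y‖ ≤ M * m * S * (1 + |x|) ^ (-(α + 1 / 2)) := by
  set H : ℝ → ℝ := fun t => (1 + |t|) ^ (-(3 / 2) : ℝ) * |t| ^ (-α) with hH
  set L : ℝ → ℝ := (Set.Icc (-(2 * d)) (2 * d)).indicator fun u : ℝ => 1 + |Real.log u| with hL
  have hHi : Integrable H := integrable_one_add_abs_rpow_mul_abs_rpow hα0.le (by linarith)
  have hLi : Integrable L := integrable_indicator_one_add_abs_log _
  have hH0 : ∀ t, 0 ≤ H t := fun t => by positivity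
  have hL0 : ∀ t, 0 ≤ L t := Set.indicator_nonneg fun t _ => by positivity
  have hIH : 0 ≤ ∫ t, H t := integral_nonneg hH0
  have hIL : 0 ≤ ∫ t, L t := integral_nonneg hL0
  set D : ℝ := (1 + d) ^ (α + 1 / 2)
  have hD0 : 0 ≤ D := by positivity
  refine ⟨(∫ t, H t) + D * (∫ t, L t) + 1, by positivity, ?_⟩
  intro m hm k hk hfar hnear σ hσ S hS x
  have hS0 : 0 ≤ S := le_trans (by positivity) (hS 0)
  set a : ℝ := 1 + |x| with ha
  have ha0 : 0 < a := by positivity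
  have hσ' : ∀ y, ‖σ y‖ ≤ S * (1 + |y|) ^ (-α) := fun y => by
    rw [Real.rpow_neg (by positivity), ← div_eq_mul_inv, le_div_iff₀ (by positivity), mul_comm]
    exact hS y
  set G : ℝ → ℝ := fun y => m * S * (a ^ (-(3 / 2) - α) * H (y / a) +
    D * a ^ (-(α + 1 / 2)) * L (x - y)) with hG
  have i1 : Integrable fun y => a ^ (-(3 / 2) - α) * H (y / a) :=
    (hHi.comp_div ha0.ne').const_mul _
  have i2 : Integrable fun y => D * a ^ (-(α + 1 / 2)) * L (x - y) :=
    (hLi.comp_sub_left x).const_mul _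
  have hGi : Integrable G := (i1.add i2).const_mul _
  have hGint : ∫ y, G y = m * S * (((∫ t, H t) + D * (∫ t, L t)) * a ^ (-(α + 1 / 2))) := by
    have e : a ^ (-(3 / 2) - α) * a = a ^ (-(α + 1 / 2)) := by
      rw [← Real.rpow_add_one ha0.ne']
      congr 1
      ring
    simp only [hG]
    rw [integral_const_mul, integral_add i1 i2, integral_const_mul, integral_const_mul,
      Measure.integral_comp_div, integral_sub_left_eq_self, abs_of_pos ha0, smul_eq_mul, ← e]
    ring
  have hbound : ∀ᵐ y : ℝ, ‖k x y * σ y‖ ≤ G y := by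
    filter_upwards [volume.ae_ne x, volume.ae_ne 0] with y hyx hy0
    have p1 : 0 ≤ a ^ (-(3 / 2) - α) * H (y / a) := mul_nonneg (by positivity) (hH0 _)
    have p2 : 0 ≤ D * a ^ (-(α + 1 / 2)) * L (x - y) := mul_nonneg (by positivity) (hL0 _)
    rw [norm_mul]
    by_cases h : d < max (|x|) (|y|)
    · calc ‖k x y‖ * ‖σ y‖
          ≤ (m * (1 + |x| + |y|) ^ (-(3 / 2) : ℝ)) * (S * (1 + |y|) ^ (-α)) :=
            mul_le_mul (hfar x y h) (hσ' y) (norm_nonneg _) (by positivity)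
        _ = m * S * ((a + |y|) ^ (-(3 / 2) : ℝ) * (1 + |y|) ^ (-α)) := by rw [ha]; ring
        _ ≤ m * S * (a ^ (-(3 / 2) - α) * H (y / a)) := by
            refine mul_le_mul_of_nonneg_left ?_ (by positivity)
            have := rpow_mul_rpow_le_rescaled hα0.le ha0 (abs_pos.mpr hy0)
            simpa only [hH, abs_div, abs_of_pos ha0] using this
        _ ≤ G y := mul_le_mul_of_nonneg_left (by linarith) (by positivity)
    · obtain ⟨hx, hy⟩ := max_le_iff.mp (not_lt.mp h)
      have hmem : x - y ∈ Set.Icc (-(2 * d)) (2 * d) := by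
        constructor <;> linarith [abs_le.mp hx, abs_le.mp hy]
      have hLv : L (x - y) = 1 + |Real.log (|x - y|)| := by
        rw [hL, Set.indicator_of_mem hmem, Real.log_abs]
      have hDa : 1 ≤ D * a ^ (-(α + 1 / 2)) := by
        rw [Real.rpow_neg ha0.le, ← div_eq_mul_inv, one_le_div (by positivity)]
        exact Real.rpow_le_rpow ha0.le (by linarith) (by linarith)
      have hσS : ‖σ y‖ ≤ S := (hσ' y).trans <| mul_le_of_le_one_right hS0 <|
        Real.rpow_le_one_of_one_le_of_nonpos (by linarith [abs_nonneg y]) (by linarith)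
      calc ‖k x y‖ * ‖σ y‖ ≤ (m * L (x - y)) * S :=
            mul_le_mul (hLv ▸ hnear x y hx hy hyx.symm) hσS (norm_nonneg _)
              (mul_nonneg hm (hL0 _))
        _ = m * S * L (x - y) := by ring
        _ ≤ G y := mul_le_mul_of_nonneg_left
            (by linarith [le_mul_of_one_le_left (hL0 (x - y)) hDa]) (by positivity)
  have hmeas : AEStronglyMeasurable (fun y => k x y * σ y) :=
    ((hk.comp measurable_prodMk_left).mul hσ.measurable).aestronglyMeasurable
  refine ⟨hGi.mono' hmeas hbound, (norm_integral_le_of_norm_le hGi hbound).trans ?_⟩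
  rw [hGint]
  have : 0 ≤ m * S * a ^ (-(α + 1 / 2)) := by positivity
  linarith
end

section
/- Let l ≥ 0 be an integer, β ∈ {−1, +1}, and let ψ be a smooth function on [0,∞) with support contained in [0,1). Then there is a constant C (depending only on ψ, l, β) such that for all α ∈ (0, 1/2) and all r ≥ 2, | ∫₀¹ e^{i r β (w + α)²} w^{2l+1} ψ(w) dw | ≤ C · r^{-(l+1)}. -/
open intervalIntegral

section

open MeasureTheory Set Filter Topology

/-- The oscillating Gaussian `x ↦ exp (i r β x²)` at the point `z + (1 + iβ) s` of the ray that
starts at the real number `z` in the direction `1 + iβ` of steepest descent. -/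
noncomputable def rayGaussian (r β z s : ℝ) : ℂ :=
  Complex.exp (Complex.I * r * β * (z + (1 + Complex.I * β) * s) ^ 2)

lemma rayGaussian_zero (r β z : ℝ) :
    rayGaussian r β z 0 = Complex.exp (Complex.I * r * β * (z : ℂ) ^ 2) := by
  simp [rayGaussian]

lemma continuous_rayGaussian (r β z : ℝ) : Continuous (rayGaussian r β z) := by
  unfold rayGaussian
  fun_prop

lemma norm_rayGaussian_le {r β : ℝ} (hr : 0 < r) (hβ : β ^ 2 = 1) {z s : ℝ} (hz : 0 ≤ z)
    (hs : 0 ≤ s) : ‖rayGaussian r β z s‖ ≤ Real.exp (-(2 * r) * s ^ 2) := by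
  rw [rayGaussian, Complex.norm_exp, Real.exp_le_exp]
  have h : (Complex.I * r * β * (z + (1 + Complex.I * β) * s) ^ 2).re
      = -(2 * r) * s * (z + s) * β ^ 2 := by
    simp [pow_two]
    ring
  rw [h, hβ]
  have := mul_nonneg (mul_nonneg hr.le hs) hz
  nlinarith

/-- The derivative of `rayGaussian` in the base point. -/
noncomputable def rayGaussianDeriv (r β z s : ℝ) : ℂ :=
  2 * Complex.I * r * β * (z + (1 + Complex.I * β) * s) * rayGaussian r β z s

lemma continuous_rayGaussianDeriv (r β z : ℝ) : Continuous (rayGaussianDeriv r β z) := by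
  have := continuous_rayGaussian r β z
  unfold rayGaussianDeriv
  fun_prop

lemma hasDerivAt_rayGaussian_base (r β z s : ℝ) :
    HasDerivAt (fun z => rayGaussian r β z s) (rayGaussianDeriv r β z s) z := by
  have h := ((((Complex.ofRealCLM.hasDerivAt (x := z)).add_const
    ((1 + Complex.I * β) * s : ℂ)).fun_pow 2).const_mul (Complex.I * r * β : ℂ)).cexp
  refine h.congr_deriv ?_
  simp [rayGaussianDeriv, rayGaussian]
  ring

lemma hasDerivAt_rayGaussian_param (r β z s : ℝ) :
    HasDerivAt (rayGaussian r β z) ((1 + Complex.I * β) * rayGaussianDeriv r β z s) s := by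
  have h := (((((Complex.ofRealCLM.hasDerivAt (x := s)).const_mul
    (1 + Complex.I * β : ℂ)).const_add (z : ℂ)).fun_pow 2).const_mul
      (Complex.I * r * β : ℂ)).cexp
  refine h.congr_deriv ?_
  simp [rayGaussianDeriv, rayGaussian]
  ring

lemma integrableOn_pow_mul_exp_neg_mul_sq {b : ℝ} (hb : 0 < b) (k : ℕ) :
    IntegrableOn (fun s : ℝ => s ^ k * Real.exp (-b * s ^ 2)) (Ioi 0) := by
  have h := integrableOn_rpow_mul_exp_neg_mul_sq hb (s := k)
    (neg_one_lt_zero.trans_le (Nat.cast_nonneg k))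
  simpa only [Real.rpow_natCast] using h

lemma norm_pow_mul_rayGaussian_le {r β : ℝ} (hr : 0 < r) (hβ : β ^ 2 = 1) {z s : ℝ} (hz : 0 ≤ z)
    (hs : 0 ≤ s) (k : ℕ) :
    ‖(s : ℂ) ^ k * rayGaussian r β z s‖ ≤ s ^ k * Real.exp (-(2 * r) * s ^ 2) := by
  rw [norm_mul, norm_pow, Complex.norm_real, Real.norm_of_nonneg hs]
  gcongr
  exact norm_rayGaussian_le hr hβ hz hs

lemma integrableOn_pow_mul_rayGaussian {r β : ℝ} (hr : 0 < r) (hβ : β ^ 2 = 1) {z : ℝ}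
    (hz : 0 ≤ z) (k : ℕ) :
    IntegrableOn (fun s : ℝ => (s : ℂ) ^ k * rayGaussian r β z s) (Ioi 0) := by
  have hc := continuous_rayGaussian r β z
  refine (integrableOn_pow_mul_exp_neg_mul_sq (b := 2 * r) (by positivity) k).mono'
    (by fun_prop) ?_
  filter_upwards [ae_restrict_mem measurableSet_Ioi] with s hs
  exact norm_pow_mul_rayGaussian_le hr hβ hz (le_of_lt hs) k

lemma pow_mul_rayGaussianDeriv (r β z s : ℝ) (k : ℕ) :
    (s : ℂ) ^ k * rayGaussianDeriv r β z s =
      2 * Complex.I * r * β * z * ((s : ℂ) ^ k * rayGaussian r β z s) +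
        2 * Complex.I * r * β * (1 + Complex.I * β) *
          ((s : ℂ) ^ (k + 1) * rayGaussian r β z s) := by
  rw [rayGaussianDeriv]
  ring

lemma integrableOn_pow_mul_rayGaussianDeriv {r β : ℝ} (hr : 0 < r) (hβ : β ^ 2 = 1) {z : ℝ}
    (hz : 0 ≤ z) (k : ℕ) :
    IntegrableOn (fun s : ℝ => (s : ℂ) ^ k * rayGaussianDeriv r β z s) (Ioi 0) := by
  simp only [pow_mul_rayGaussianDeriv]
  exact ((integrableOn_pow_mul_rayGaussian hr hβ hz k).const_mul _).add
    ((integrableOn_pow_mul_rayGaussian hr hβ hz (k + 1)).const_mul _)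

/-- The `k`-th moment of the oscillating Gaussian along the ray of steepest descent at `z`. -/
noncomputable def rayMoment (r β : ℝ) (k : ℕ) (z : ℝ) : ℂ :=
  ∫ s in Ioi (0 : ℝ), (s : ℂ) ^ k * rayGaussian r β z s

lemma hasDerivAt_rayMoment {r β : ℝ} (hr : 0 < r) (hβ : β ^ 2 = 1) {z : ℝ} (hz : 0 < z) (k : ℕ) :
    HasDerivAt (rayMoment r β k)
      (∫ s in Ioi (0 : ℝ), (s : ℂ) ^ k * rayGaussianDeriv r β z s) z := by
  have hc := continuous_rayGaussian r β
  have hc' := continuous_rayGaussianDeriv r β z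
  have hint := integrableOn_pow_mul_exp_neg_mul_sq (b := 2 * r) (by positivity)
  refine (hasDerivAt_integral_of_dominated_loc_of_deriv_le
    (F := fun z s => (s : ℂ) ^ k * rayGaussian r β z s)
    (F' := fun z s => (s : ℂ) ^ k * rayGaussianDeriv r β z s)
    (bound := fun s => ‖2 * Complex.I * r * β‖ * (z + 1) *
        (s ^ k * Real.exp (-(2 * r) * s ^ 2)) +
      ‖2 * Complex.I * r * β * (1 + Complex.I * β)‖ *
        (s ^ (k + 1) * Real.exp (-(2 * r) * s ^ 2)))
    (Ioo_mem_nhds hz (lt_add_one z)) (Eventually.of_forall fun x => ?_)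
    (integrableOn_pow_mul_rayGaussian hr hβ hz.le k) ?_ ?_
    (((hint k).const_mul _).add ((hint (k + 1)).const_mul _)) ?_).2
  · have := hc x
    fun_prop
  · fun_prop
  · filter_upwards [ae_restrict_mem measurableSet_Ioi] with s hs x hx
    have hs' : 0 ≤ s := le_of_lt hs
    rw [pow_mul_rayGaussianDeriv]
    refine (norm_add_le _ _).trans ?_
    rw [norm_mul, norm_mul _ ((s : ℂ) ^ (k + 1) * _), norm_mul _ (x : ℂ), Complex.norm_real,
      Real.norm_of_nonneg hx.1.le]
    gcongr
    · exact hx.2.le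
    · exact norm_pow_mul_rayGaussian_le hr hβ hx.1.le hs' k
    · exact norm_pow_mul_rayGaussian_le hr hβ hx.1.le hs' (k + 1)
  · exact Eventually.of_forall fun s x _ => (hasDerivAt_rayGaussian_base r β x s).const_mul _

lemma integral_pow_mul_rayGaussianDeriv {r β : ℝ} (hr : 0 < r) (hβ : β ^ 2 = 1) {z : ℝ}
    (hz : 0 ≤ z) (k : ℕ) :
    (1 + Complex.I * β) * ∫ s in Ioi (0 : ℝ), (s : ℂ) ^ k * rayGaussianDeriv r β z s =
      -(0 ^ k * rayGaussian r β z 0) - k * rayMoment r β (k - 1) z := by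
  have hd (s : ℝ) : HasDerivAt (fun s : ℝ => (s : ℂ) ^ k * rayGaussian r β z s)
      (k * ((s : ℂ) ^ (k - 1) * rayGaussian r β z s) +
        (1 + Complex.I * β) * ((s : ℂ) ^ k * rayGaussianDeriv r β z s)) s := by
    refine (((Complex.ofRealCLM.hasDerivAt (x := s)).fun_pow k).fun_mul
      (hasDerivAt_rayGaussian_param r β z s)).congr_deriv ?_
    simp
    ring
  have h₁ := (integrableOn_pow_mul_rayGaussian hr hβ hz (k - 1)).const_mul (k : ℂ)
  have h₂ := (integrableOn_pow_mul_rayGaussianDeriv hr hβ hz k).const_mul (1 + Complex.I * β)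
  have h := integral_Ioi_of_hasDerivAt_of_tendsto' (a := 0) (fun s _ => hd s) (h₁.add h₂)
    (tendsto_zero_of_hasDerivAt_of_integrableOn_Ioi (a := 0) (fun s _ => hd s) (h₁.add h₂)
      (integrableOn_pow_mul_rayGaussian hr hβ hz k))
  rw [MeasureTheory.integral_add h₁ h₂, MeasureTheory.integral_const_mul,
    MeasureTheory.integral_const_mul] at h
  rw [rayMoment, eq_sub_iff_add_eq, add_comm, h]
  simp

/-- Iterated primitives, up to sign, of `z ↦ exp (i r β z²)` on the positive half-line. -/
noncomputable def iteratedPrimitive (r β : ℝ) : ℕ → ℝ → ℂ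
  | 0, z => rayGaussian r β z 0
  | k + 1, z => (1 + Complex.I * β) ^ (k + 1) / k.factorial * rayMoment r β k z

lemma hasDerivAt_iteratedPrimitive_succ {r β : ℝ} (hr : 0 < r) (hβ : β ^ 2 = 1) {z : ℝ}
    (hz : 0 < z) (k : ℕ) :
    HasDerivAt (iteratedPrimitive r β (k + 1)) (-iteratedPrimitive r β k z) z := by
  have h := (hasDerivAt_rayMoment hr hβ hz k).const_mul
    ((1 + Complex.I * β) ^ (k + 1) / k.factorial : ℂ)
  have h' := integral_pow_mul_rayGaussianDeriv hr hβ hz.le k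
  refine h.congr_deriv ?_
  rw [pow_succ, mul_div_right_comm, mul_assoc, h']
  cases k with
  | zero => simp [iteratedPrimitive]
  | succ k =>
    have : (k.factorial : ℂ) ≠ 0 := by exact_mod_cast k.factorial_ne_zero
    have : (k + 1 : ℂ) ≠ 0 := by exact_mod_cast k.succ_ne_zero
    simp [iteratedPrimitive, Nat.factorial_succ]
    field_simp

lemma continuousAt_iteratedPrimitive {r β : ℝ} (hr : 0 < r) (hβ : β ^ 2 = 1) {z : ℝ}
    (hz : 0 < z) (k : ℕ) : ContinuousAt (iteratedPrimitive r β k) z := by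
  cases k with
  | zero => exact (hasDerivAt_rayGaussian_base r β z 0).continuousAt
  | succ k => exact (hasDerivAt_iteratedPrimitive_succ hr hβ hz k).continuousAt

lemma norm_rayMoment_le {r β : ℝ} (hr : 0 < r) (hβ : β ^ 2 = 1) {z : ℝ} (hz : 0 ≤ z) (l : ℕ) :
    ‖rayMoment r β (2 * l + 1) z‖ ≤ l.factorial / r ^ (l + 1) := by
  have h : ‖rayMoment r β (2 * l + 1) z‖ ≤
      ∫ s in Ioi (0 : ℝ), s ^ (2 * l + 1) * Real.exp (-(2 * r) * s ^ 2) := by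
    refine norm_integral_le_of_norm_le
      (integrableOn_pow_mul_exp_neg_mul_sq (b := 2 * r) (by positivity) _) ?_
    filter_upwards [ae_restrict_mem measurableSet_Ioi] with s hs
    exact norm_pow_mul_rayGaussian_le hr hβ hz (le_of_lt hs) _
  refine h.trans ?_
  have hg := integral_rpow_mul_exp_neg_mul_rpow (p := 2) (q := (2 * l + 1 : ℕ)) (b := 2 * r)
    two_pos (neg_one_lt_zero.trans_le (Nat.cast_nonneg _)) (by positivity)
  simp only [Real.rpow_natCast, Real.rpow_two] at hg
  have he : (((2 * l + 1 : ℕ) : ℝ) + 1) / 2 = (l : ℝ) + 1 := by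
    push_cast
    ring
  have he' : -(((2 * l + 1 : ℕ) : ℝ) + 1) / 2 = -((l + 1 : ℕ) : ℝ) := by
    push_cast
    ring
  rw [hg, he, he', Real.Gamma_nat_eq_factorial, Real.rpow_neg (by positivity), Real.rpow_natCast,
    mul_comm, div_eq_mul_inv]
  refine mul_le_mul_of_nonneg_left ?_ (by positivity)
  have : r ^ (l + 1) ≤ (2 * r) ^ (l + 1) := by
    gcongr
    linarith
  have := inv_anti₀ (by positivity) this
  have : 0 ≤ ((2 * r) ^ (l + 1))⁻¹ := by positivity
  linarith

lemma norm_iteratedPrimitive_le {r β : ℝ} (hr : 0 < r) (hβ : β ^ 2 = 1) {z : ℝ} (hz : 0 ≤ z)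
    (l : ℕ) : ‖iteratedPrimitive r β (2 * l + 2) z‖ ≤
      ‖(1 + Complex.I * β) ^ (2 * l + 2) / ((2 * l + 1).factorial : ℂ)‖ * l.factorial /
        r ^ (l + 1) := by
  rw [iteratedPrimitive, norm_mul, mul_div_assoc]
  gcongr
  exact norm_rayMoment_le hr hβ hz l

lemma integral_iteratedPrimitive_mul {r β α : ℝ} (hr : 0 < r) (hβ : β ^ 2 = 1) (hα : 0 < α)
    {g g' : ℝ → ℂ} (hg : ∀ w, HasDerivAt g (g' w) w) (hg' : Continuous g') (hg1 : g 1 = 0)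
    (k : ℕ) :
    ∫ w in (0 : ℝ)..1, iteratedPrimitive r β k (w + α) * g w =
      iteratedPrimitive r β (k + 1) α * g 0 +
        ∫ w in (0 : ℝ)..1, iteratedPrimitive r β (k + 1) (w + α) * g' w := by
  have hpos {w : ℝ} (hw : w ∈ uIcc (0 : ℝ) 1) : 0 < w + α := by
    rw [uIcc_of_le zero_le_one] at hw
    linarith [hw.1]
  have h := intervalIntegral.integral_mul_deriv_eq_deriv_mul (a := 0) (b := 1)
    (u := fun w => iteratedPrimitive r β (k + 1) (w + α))
    (u' := fun w => -iteratedPrimitive r β k (w + α))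
    (fun w hw => (hasDerivAt_iteratedPrimitive_succ hr hβ (hpos hw) k).comp_add_const w α)
    (fun w _ => hg w)
    (ContinuousOn.intervalIntegrable fun w hw =>
      (ContinuousAt.comp (f := fun w : ℝ => w + α) (continuousAt_iteratedPrimitive hr hβ (hpos hw) k)
        (by fun_prop)).neg.continuousWithinAt)
    (hg'.intervalIntegrable _ _)
  rw [h, hg1]
  simp

lemma integral_rayGaussian_mul_eq {r β α : ℝ} (hr : 0 < r) (hβ : β ^ 2 = 1) (hα : 0 < α)
    {g : ℝ → ℂ} (hg : ContDiff ℝ (⊤ : ℕ∞) g) {n : ℕ} (hg0 : ∀ j < n, iteratedDeriv j g 0 = 0)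
    (hg1 : ∀ j, iteratedDeriv j g 1 = 0) {k : ℕ} (hk : k ≤ n + 1) :
    ∫ w in (0 : ℝ)..1, rayGaussian r β (w + α) 0 * g w =
      (if k = n + 1 then iteratedPrimitive r β k α * iteratedDeriv n g 0 else 0) +
        ∫ w in (0 : ℝ)..1, iteratedPrimitive r β k (w + α) * iteratedDeriv k g w := by
  induction k with
  | zero => simp [iteratedPrimitive]
  | succ k ih =>
    have hd (w : ℝ) : HasDerivAt (iteratedDeriv k g) (iteratedDeriv (k + 1) g w) w := by
      rw [iteratedDeriv_succ]
      exact (hg.differentiable_iteratedDeriv k (mod_cast ENat.natCast_lt_top k) w).hasDerivAt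
    rw [ih (by omega), if_neg (by omega), zero_add, integral_iteratedPrimitive_mul hr hβ hα hd
      (hg.continuous_iteratedDeriv _ (mod_cast le_top)) (hg1 k)]
    congr 1
    split_ifs with h
    · rw [Nat.succ_injective h]
    · rw [hg0 k (by omega), mul_zero]

lemma iteratedDeriv_pow_mul_zero {h : ℝ → ℂ} (hh : ContDiff ℝ (⊤ : ℕ∞) h) {j m : ℕ} (hj : j < m) :
    iteratedDeriv j (fun w : ℝ => (w : ℂ) ^ m * h w) 0 = 0 := by
  induction j generalizing m h with
  | zero => simp [(Nat.pos_of_ne_zero (by omega) : 0 < m).ne']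
  | succ j ih =>
    obtain ⟨m, rfl⟩ : ∃ k, m = k + 1 := ⟨m - 1, by omega⟩
    have hd : deriv (fun w : ℝ => (w : ℂ) ^ (m + 1) * h w) =
        fun w : ℝ => (w : ℂ) ^ m * ((m + 1) * h w + w * deriv h w) := by
      ext w
      have h₁ := ((Complex.ofRealCLM.hasDerivAt (x := w)).pow (m + 1)).mul
        (hh.differentiable (by simp) w).hasDerivAt
      refine h₁.deriv.trans ?_
      simp
      ring
    rw [iteratedDeriv_succ', hd]
    have hh' : ContDiff ℝ (⊤ : ℕ∞) (deriv h) := (contDiff_infty_iff_deriv.1 hh).2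
    have hw : ContDiff ℝ (⊤ : ℕ∞) (fun w : ℝ => (w : ℂ)) := Complex.ofRealCLM.contDiff
    exact ih (by fun_prop) (by omega)

lemma iteratedDeriv_eq_zero_of_forall_ge {g : ℝ → ℂ} (hg : ContDiff ℝ (⊤ : ℕ∞) g) {a : ℝ}
    (h : ∀ w, a ≤ w → g w = 0) (j : ℕ) : iteratedDeriv j g a = 0 := by
  have hc : Continuous (iteratedDeriv j g) := hg.continuous_iteratedDeriv _ (mod_cast le_top)
  have hz : ∀ w ∈ Ioi a, iteratedDeriv j g w = 0 := by
    intro w hw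
    have he : g =ᶠ[𝓝 w] fun _ => 0 := by
      filter_upwards [Ioi_mem_nhds hw] with x hx using h x (le_of_lt hx)
    rw [he.iteratedDeriv_eq]
    simp
  have := closure_minimal hz (isClosed_singleton.preimage hc)
  rw [closure_Ioi] at this
  exact this self_mem_Ici

end

/-- Let `l ≥ 0`, `β = ±1`, and `ψ` smooth with support in `[0,1)`.
There is a constant `C` (depending only on `ψ, l, β`) such that for all `α ∈ (0,1/2)`
and `r ≥ 2`, `|∫₀¹ e^{irβ(w+α)²} w^{2l+1} ψ(w) dw| ≤ C r^{-(l+1)}`. -/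
theorem exterior_stationary_point_estimate (l : ℕ) (β : ℝ) (hβ : β = 1 ∨ β = -1)
    (ψ : ℝ → ℂ) (hψ : ContDiff ℝ (⊤ : ℕ∞) ψ) (hsupp : ∀ w : ℝ, 1 ≤ w → ψ w = 0) :
    ∃ C : ℝ, ∀ α ∈ Set.Ioo (0 : ℝ) (1 / 2), ∀ r : ℝ, 2 ≤ r →
      ‖∫ w in (0 : ℝ)..1,
          Complex.exp (Complex.I * (r : ℂ) * (β : ℂ) * ((w + α : ℝ) : ℂ) ^ 2) *
            (w : ℂ) ^ (2 * l + 1) * ψ w‖ ≤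
        C / r ^ (l + 1) := by
  have hβ2 : β ^ 2 = 1 := by rcases hβ with rfl | rfl <;> norm_num
  set g : ℝ → ℂ := fun w => (w : ℂ) ^ (2 * l + 1) * ψ w with hg_def
  have hw : ContDiff ℝ (⊤ : ℕ∞) (fun w : ℝ => (w : ℂ)) := Complex.ofRealCLM.contDiff
  have hg : ContDiff ℝ (⊤ : ℕ∞) g := (hw.pow _).mul hψ
  have hg1 := iteratedDeriv_eq_zero_of_forall_ge hg (a := 1) fun w h => by
    simp [hg_def, hsupp w h]
  have hcont (j : ℕ) : Continuous (iteratedDeriv j g) :=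
    hg.continuous_iteratedDeriv j (mod_cast le_top)
  obtain ⟨M, hM⟩ := (isCompact_Icc (a := (0 : ℝ)) (b := 1)).exists_bound_of_continuousOn
    (hcont (2 * l + 2)).continuousOn
  obtain ⟨A, hA⟩ : ∃ A, A =
      ‖(1 + Complex.I * β) ^ (2 * l + 2) / ((2 * l + 1).factorial : ℂ)‖ * l.factorial :=
    ⟨_, rfl⟩
  refine ⟨A * ‖iteratedDeriv (2 * l + 1) g 0‖ + A * M, fun α hα r hr => ?_⟩
  have hr0 : 0 < r := by linarith
  have hα0 : 0 < α := hα.1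
  have hb {w : ℝ} (h : 0 ≤ w) : ‖iteratedPrimitive r β (2 * l + 2) w‖ ≤ A / r ^ (l + 1) :=
    hA ▸ norm_iteratedPrimitive_le hr0 hβ2 h l
  have h := integral_rayGaussian_mul_eq hr0 hβ2 hα0 hg (n := 2 * l + 1)
    (fun j hj => iteratedDeriv_pow_mul_zero hψ hj) hg1 le_rfl
  simp only [rayGaussian_zero, if_true, hg_def, ← mul_assoc] at h
  rw [h, add_div, mul_div_right_comm, mul_div_right_comm A M]
  refine (norm_add_le _ _).trans (add_le_add ?_ ?_)
  · rw [norm_mul]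
    gcongr
    exact hb hα0.le
  · have hA0 := (norm_nonneg _).trans (hb hα0.le)
    refine (intervalIntegral.norm_integral_le_of_norm_le_const
      (C := A / r ^ (l + 1) * M) fun w hw => ?_).trans_eq (by simp)
    rw [Set.uIoc_of_le zero_le_one] at hw
    rw [norm_mul]
    gcongr
    · exact hb (by linarith [hw.1])
    · exact hM w ⟨hw.1.le, hw.2⟩
end
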